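/- arXiv:2602.04643 — 3 statements merged into one kernel-verified Lean document; each statement's English description precedes it below -/
import Mathlib

section
/- Let K ≥ 2 and let p ∈ ℝ^K be a probability vector (p k ≥ 0, ∑_k p k = 1) whose maximum entry is p_max := max_k p k. Then the Shannon entropy of p satisfies the Fano-type upper bound H(p) ≤ H_b(p_max) + (1 − p_max) · log(K − 1), where H(p) = −∑_k p_k log p_k and H_b(x) = −x log x − (1 − x) log(1 − x) is the binary entropy function (with the convention 0 log 0 = 0). -/
/-- Shannon entropy of a finite probability vector (with `0 * log 0 = 0`,
which holds by Lean's convention `log 0 = 0`). -/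
noncomputable def shannonEntropy {K : ℕ} (p : Fin K → ℝ) : ℝ :=
  -∑ k, p k * Real.log (p k)

/-- Binary entropy function. -/
noncomputable def binEntropy (x : ℝ) : ℝ :=
  -(x * Real.log x) - (1 - x) * Real.log (1 - x)

/-- Fano-type entropy bound: for a probability vector on `Fin K`
with maximum entry `pmax`, `H(p) ≤ H_b(pmax) + (1 - pmax) log (K - 1)`. -/
theorem entropy_le_fano_bound {K : ℕ} (hK : 2 ≤ K)
    (p : Fin K → ℝ) (hp0 : ∀ k, 0 ≤ p k) (hp1 : ∑ k, p k = 1)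
    (pmax : ℝ)
    (hpmax : pmax = Finset.univ.sup' (Finset.univ_nonempty_iff.mpr ⟨⟨0, by omega⟩⟩) p) :
    shannonEntropy p ≤ binEntropy pmax + (1 - pmax) * Real.log ((K : ℝ) - 1) := by
  obtain ⟨m, -, hm⟩ := Finset.exists_mem_eq_sup' (s := (Finset.univ : Finset (Fin K)))
    (Finset.univ_nonempty_iff.mpr ⟨⟨0, by omega⟩⟩) p
  have hpm : pmax = p m := hpmax.trans hm
  have hn : (0 : ℝ) < (K : ℝ) - 1 := by
    have : (2 : ℝ) ≤ K := by exact_mod_cast hK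
    linarith
  have hcard : ((Finset.univ.erase m).card : ℝ) = (K : ℝ) - 1 := by
    rw [Finset.card_erase_of_mem (Finset.mem_univ m), Finset.card_univ, Fintype.card_fin,
      Nat.cast_sub (by omega)]
    simp
  have hS : ∑ k ∈ Finset.univ.erase m, p k = 1 - pmax := by
    have := Finset.add_sum_erase Finset.univ p (Finset.mem_univ m)
    linarith
  have hE := Finset.add_sum_erase Finset.univ (fun k => p k * Real.log (p k)) (Finset.mem_univ m)
  have hJ := Real.convexOn_mul_log.map_sum_le (t := Finset.univ.erase m)
    (w := fun _ => ((K : ℝ) - 1)⁻¹) (p := p) (fun _ _ => (inv_pos.mpr hn).le)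
    (by rw [Finset.sum_const, nsmul_eq_mul, hcard, mul_inv_cancel₀ hn.ne'])
    (fun k _ => hp0 k)
  simp only [smul_eq_mul, ← Finset.mul_sum, hS] at hJ
  rw [mul_assoc] at hJ
  have hJ2 := le_of_mul_le_mul_left hJ (inv_pos.mpr hn)
  have hlog : (1 - pmax) * Real.log (((K : ℝ) - 1)⁻¹ * (1 - pmax)) =
      (1 - pmax) * Real.log (1 - pmax) - (1 - pmax) * Real.log ((K : ℝ) - 1) := by
    by_cases h : 1 - pmax = 0
    · simp [h]
    · rw [Real.log_mul (inv_pos.mpr hn).ne' h, Real.log_inv]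
      ring
  rw [hlog] at hJ2
  simp only [← hpm] at hE
  unfold shannonEntropy binEntropy
  linarith
end

section
/- Let K ≥ 2, let p̄ ∈ ℝ^K be a probability vector (p̄ k ≥ 0, ∑_k p̄ k = 1), let m be an index achieving the maximum entry p̄_max = p̄ m, and let η > 0. Let ρ* ∈ (1/K, 1) satisfy φ(ρ*) = η, where φ(x) := H_b(x) + (1 − x) log(K − 1) with H_b the binary entropy. If the Shannon entropy satisfies H(p̄) ≥ η, then: (i) p̄_max ≤ ρ*; and (ii) there exists an index r ≠ m such that p̄ r ≥ (1 − ρ*)/(K − 1). In other words, an entropy lower bound forces at least two codes to carry non-negligible probability mass. -/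
/-- entropy lower bound implies at least two active codes:
if `H(p̄) ≥ η = φ(ρ*)` with `ρ* ∈ (1/K, 1)`, then the maximum entry satisfies
`p̄ m ≤ ρ*`, and some other index `r ≠ m` carries mass at least
`(1 - ρ*)/(K - 1)`. -/
theorem entropy_forces_two_active_codes {K : ℕ} (hK : 2 ≤ K)
    (p : Fin K → ℝ) (hp0 : ∀ k, 0 ≤ p k) (hp1 : ∑ k, p k = 1)
    (m : Fin K) (hm : ∀ k, p k ≤ p m)
    (η ρ : ℝ) (hη : 0 < η)
    (hρ_lo : 1 / (K : ℝ) < ρ) (hρ_hi : ρ < 1)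
    (hρ_root : binEntropy ρ + (1 - ρ) * Real.log ((K : ℝ) - 1) = η)
    (hH : η ≤ shannonEntropy p) :
    p m ≤ ρ ∧ ∃ r, r ≠ m ∧ (1 - ρ) / ((K : ℝ) - 1) ≤ p r := by
  classical
  have hK' : (2 : ℝ) ≤ (K : ℝ) := by exact_mod_cast hK
  have hK1 : (0 : ℝ) < (K : ℝ) - 1 := by linarith
  have hK0 : (0 : ℝ) < (K : ℝ) := by linarith
  have hρ0 : 0 < ρ := lt_trans (by positivity) hρ_lo
  set s : ℝ := (1 - ρ) / ((K : ℝ) - 1) with hs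
  have hs0 : 0 < s := div_pos (by linarith) hK1
  have hKs : ((K : ℝ) - 1) * s = 1 - ρ := by rw [hs]; field_simp
  have hsρ : s < ρ := by
    rw [div_lt_iff₀ hK0] at hρ_lo
    rw [hs, div_lt_iff₀ hK1]
    nlinarith
  have hlog : Real.log s < Real.log ρ := Real.log_lt_log hs0 hsρ
  have hlogs : Real.log s = Real.log (1 - ρ) - Real.log ((K : ℝ) - 1) :=
    Real.log_div (by linarith) hK1.ne'
  have hsum : ∑ k ∈ Finset.univ.erase m, p k = 1 - p m := by
    have := Finset.add_sum_erase Finset.univ p (Finset.mem_univ m)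
    linarith
  have hcard : ((Finset.univ.erase m).card : ℝ) = (K : ℝ) - 1 := by
    rw [Finset.card_erase_of_mem (Finset.mem_univ m), Finset.card_univ, Fintype.card_fin,
      Nat.cast_sub (by omega)]
    simp
  have gibbs : ∀ a q : ℝ, 0 ≤ a → 0 < q → -(a * Real.log a) ≤ -(a * Real.log q) + (q - a) := by
    intro a q ha hq
    rcases ha.eq_or_lt with rfl | ha
    · simp; exact hq.le
    · have h1 := Real.log_le_sub_one_of_pos (div_pos hq ha)
      rw [Real.log_div hq.ne' ha.ne'] at h1
      have h2 := mul_le_mul_of_nonneg_left h1 ha.le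
      have h3 : a * (q / a - 1) = q - a := by field_simp
      rw [h3] at h2
      linarith
  have hHle : shannonEntropy p ≤ -(p m * Real.log ρ) - (1 - p m) * Real.log s := by
    have e : shannonEntropy p =
        -(p m * Real.log (p m)) + ∑ k ∈ Finset.univ.erase m, -(p k * Real.log (p k)) := by
      unfold shannonEntropy
      rw [← Finset.add_sum_erase Finset.univ _ (Finset.mem_univ m), Finset.sum_neg_distrib]
      ring
    have h1 := gibbs (p m) ρ (hp0 m) hρ0
    have h2 : ∑ k ∈ Finset.univ.erase m, -(p k * Real.log (p k)) ≤
        ∑ k ∈ Finset.univ.erase m, (-(p k * Real.log s) + (s - p k)) :=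
      Finset.sum_le_sum fun k _ => gibbs (p k) s (hp0 k) hs0
    rw [Finset.sum_add_distrib, Finset.sum_neg_distrib, Finset.sum_neg_distrib, ← Finset.sum_mul,
      Finset.sum_sub_distrib, hsum, Finset.sum_const, nsmul_eq_mul, hcard, hKs] at h2
    rw [e, Finset.sum_neg_distrib]
    linarith
  have hx : p m ≤ ρ := by
    unfold binEntropy at hρ_root
    by_contra! hc
    have := mul_pos (sub_pos.2 hc) (sub_pos.2 hlog)
    have e : (1 - ρ) * Real.log s =
        (1 - ρ) * Real.log (1 - ρ) - (1 - ρ) * Real.log ((K : ℝ) - 1) := by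
      rw [hlogs]; ring
    nlinarith
  refine ⟨hx, ?_⟩
  have hne : (Finset.univ.erase m).Nonempty := by
    rw [← Finset.card_pos]
    have : (0 : ℝ) < ((Finset.univ.erase m).card : ℝ) := by rw [hcard]; exact hK1
    exact_mod_cast this
  obtain ⟨r, hr, hle⟩ := Finset.exists_le_of_sum_le (f := fun _ => s) (g := p) hne (by
    rw [hsum, Finset.sum_const, nsmul_eq_mul, hcard, hKs]; linarith)
  exact ⟨r, Finset.ne_of_mem_erase hr, hle⟩
end

section
/- Let K ≥ 2, D ≥ 1, let c : Fin K → ℝ^D be prototypes with geometric radius M := max_k ‖c k‖₂, and let B ≥ 1. Let p_1, …, p_B ∈ ℝ^K be probability vectors with soft-quantized embeddings z_i := ∑_k p_{i,k} • c_k, batch marginal p̄ := (1/B) ∑_i p_i, and for each i a dominant index k(i) ∈ Fin K. Fix two distinct indices m, r ∈ Fin K, constants ε ∈ [0,1), β > 0, Δ_c > 0, and set α := β − ε. Assume: (i) assignment sharpness, ∑_k |p_{i,k} − (e_{k(i)})_k| ≤ ε for every i; (ii) two non-negligible codes, p̄_m ≥ β and p̄_r ≥ β; (iii) prototype separation, ‖c_m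 − c_r‖₂ ≥ Δ_c; and (iv) α > 0 and 2·M·ε < Δ_c. Then the trace of the batch covariance of the embeddings satisfies (1/B) ∑_{i=1}^B ‖z_i − z̄‖₂² ≥ α² · (Δ_c − 2·M·ε)² > 0, where z̄ = (1/B) ∑_i z_i. In particular, the batch of soft-quantized embeddings cannot collapse to a single point. -/
/-- explicit variance lower bound / non-collapse: under
assignment sharpness, two non-negligible codes in the batch marginal, and
prototype separation, the trace of the batch covariance of the soft-quantized
embeddings is at least `α² (Δ_c - 2Mε)² > 0`. -/
theorem variance_lower_bound_non_collapse {K D B : ℕ}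
    (hK : 2 ≤ K) (hD : 1 ≤ D) (hB : 1 ≤ B)
    (c : Fin K → EuclideanSpace ℝ (Fin D)) (M : ℝ)
    (hM : M = Finset.univ.sup' (Finset.univ_nonempty_iff.mpr ⟨⟨0, by omega⟩⟩)
      (fun k => ‖c k‖))
    (p : Fin B → Fin K → ℝ)
    (hp0 : ∀ i k, 0 ≤ p i k) (hp1 : ∀ i, ∑ k, p i k = 1)
    (kdom : Fin B → Fin K)
    (m r : Fin K) (hmr : m ≠ r)
    (ε β Δc α : ℝ)
    (hε0 : 0 ≤ ε) (hε1 : ε < 1) (hβ : 0 < β) (hΔc : 0 < Δc)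
    (hα : α = β - ε)
    -- (i) assignment sharpness
    (hsharp : ∀ i, ∑ j, |p i j - (if j = kdom i then (1 : ℝ) else 0)| ≤ ε)
    -- (ii) two non-negligible codes in the batch marginal
    (hpm : β ≤ (1 / (B : ℝ)) * ∑ i, p i m)
    (hpr : β ≤ (1 / (B : ℝ)) * ∑ i, p i r)
    -- (iii) prototype separation
    (hsep : Δc ≤ ‖c m - c r‖)
    -- (iv) non-degeneracy
    (hαpos : 0 < α) (hMε : 2 * M * ε < Δc) :
    α ^ 2 * (Δc - 2 * M * ε) ^ 2
      ≤ (1 / (B : ℝ)) *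
          ∑ i, ‖(∑ k, p i k • c k)
            - (1 / (B : ℝ)) • ∑ i', ∑ k, p i' k • c k‖ ^ 2
    ∧ 0 < α ^ 2 * (Δc - 2 * M * ε) ^ 2 := by
  have hBpos : (0 : ℝ) < B := by exact_mod_cast hB
  have hcM : ∀ k, ‖c k‖ ≤ M := by
    intro k
    rw [hM]
    exact Finset.le_sup' (fun k => ‖c k‖) (Finset.mem_univ k)
  have hM0 : 0 ≤ M := le_trans (norm_nonneg _) (hcM m)
  have hδ : 0 < Δc - 2 * M * ε := by linarith
  refine ⟨?_, by positivity⟩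
  have hz : ∀ i, ‖(∑ k, p i k • c k) - c (kdom i)‖ ≤ M * ε := by
    intro i
    have e : (∑ k, p i k • c k) - c (kdom i)
        = ∑ k, (p i k - (if k = kdom i then (1 : ℝ) else 0)) • c k := by
      simp [sub_smul, Finset.sum_sub_distrib]
    rw [e]
    calc _ ≤ ∑ k, ‖(p i k - (if k = kdom i then (1 : ℝ) else 0)) • c k‖ := norm_sum_le _ _
      _ ≤ ∑ k, M * |p i k - (if k = kdom i then (1 : ℝ) else 0)| := by
        refine Finset.sum_le_sum fun k _ => ?_
        rw [norm_smul, Real.norm_eq_abs, mul_comm]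
        exact mul_le_mul_of_nonneg_right (hcM k) (abs_nonneg _)
      _ ≤ M * ε := by
        rw [← Finset.mul_sum]
        exact mul_le_mul_of_nonneg_left (hsharp i) hM0
  have hcount : ∀ s : Fin K, β ≤ (1 / (B : ℝ)) * ∑ i, p i s →
      α * B ≤ ∑ i, (if s = kdom i then (1 : ℝ) else 0) := by
    intro s hs
    have h1 : ∑ i, p i s ≤ ∑ i, ((if s = kdom i then (1 : ℝ) else 0) + ε) := by
      refine Finset.sum_le_sum fun i _ => ?_
      have h2 := Finset.single_le_sum
        (f := fun j => |p i j - (if j = kdom i then (1 : ℝ) else 0)|)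
        (fun j _ => abs_nonneg _) (Finset.mem_univ s)
      have h3 := le_abs_self (p i s - (if s = kdom i then (1 : ℝ) else 0))
      have h4 := hsharp i
      linarith
    rw [Finset.sum_add_distrib] at h1
    simp only [Finset.sum_const, Finset.card_univ, Fintype.card_fin, nsmul_eq_mul] at h1
    rw [one_div, inv_mul_eq_div, le_div_iff₀ hBpos] at hs
    rw [hα]
    linarith
  have hF := hcount m hpm
  have hG := hcount r hpr
  have hFG : (∑ i, (if m = kdom i then (1 : ℝ) else 0))
      + ∑ i, (if r = kdom i then (1 : ℝ) else 0) ≤ B := by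
    rw [← Finset.sum_add_distrib]
    calc _ ≤ ∑ i : Fin B, (1 : ℝ) := by
          refine Finset.sum_le_sum fun i _ => ?_
          by_cases h1 : m = kdom i
          · have h2 : r ≠ kdom i := fun h => hmr (h1.trans h.symm)
            rw [if_pos h1, if_neg h2]; norm_num
          · rw [if_neg h1]; split_ifs <;> norm_num
      _ = B := by simp
  generalize (1 / (B : ℝ)) • ∑ i', ∑ k, p i' k • c k = w
  obtain ⟨a, ha⟩ : ∃ a, a = max (‖c m - w‖ - M * ε) 0 := ⟨_, rfl⟩
  obtain ⟨b, hb⟩ : ∃ b, b = max (‖c r - w‖ - M * ε) 0 := ⟨_, rfl⟩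
  have hab : Δc - 2 * M * ε ≤ a + b := by
    have h1 : ‖c m - c r‖ ≤ ‖c m - w‖ + ‖c r - w‖ := by
      have := norm_sub_le (c m - w) (c r - w)
      simpa using this
    have h2 := le_max_left (‖c m - w‖ - M * ε) 0
    have h3 := le_max_left (‖c r - w‖ - M * ε) 0
    rw [← ha] at h2
    rw [← hb] at h3
    linarith
  have hkey : ∀ i (s : Fin K), s = kdom i →
      (max (‖c s - w‖ - M * ε) 0) ^ 2 ≤ ‖(∑ k, p i k • c k) - w‖ ^ 2 := by
    intro i s hs
    refine pow_le_pow_left₀ (le_max_right _ _) (max_le ?_ (norm_nonneg _)) 2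
    have h1 := hz i
    rw [← hs, norm_sub_rev] at h1
    have h2 := norm_sub_le_norm_sub_add_norm_sub (c s) (∑ k, p i k • c k) w
    linarith
  have hsum : (∑ i, (if m = kdom i then (1 : ℝ) else 0)) * a ^ 2
      + (∑ i, (if r = kdom i then (1 : ℝ) else 0)) * b ^ 2
      ≤ ∑ i, ‖(∑ k, p i k • c k) - w‖ ^ 2 := by
    rw [Finset.sum_mul, Finset.sum_mul, ← Finset.sum_add_distrib]
    refine Finset.sum_le_sum fun i _ => ?_
    by_cases h1 : m = kdom i
    · have h2 : r ≠ kdom i := fun h => hmr (h1.trans h.symm)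
      rw [if_pos h1, if_neg h2, ha]
      linarith [hkey i m h1]
    · by_cases h2 : r = kdom i
      · rw [if_neg h1, if_pos h2, hb]
        linarith [hkey i r h2]
      · rw [if_neg h1, if_neg h2]
        simp only [zero_mul, add_zero]
        positivity
  generalize (∑ i, (if m = kdom i then (1 : ℝ) else 0)) = F at *
  generalize (∑ i, (if r = kdom i then (1 : ℝ) else 0)) = G at *
  have hα2 : 2 * α ≤ 1 := by
    by_contra! h
    nlinarith
  have h1 : α * B * (a ^ 2 + b ^ 2) ≤ F * a ^ 2 + G * b ^ 2 := by
    nlinarith [mul_le_mul_of_nonneg_right hF (sq_nonneg a),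
      mul_le_mul_of_nonneg_right hG (sq_nonneg b)]
  have h2 : (Δc - 2 * M * ε) ^ 2 ≤ 2 * (a ^ 2 + b ^ 2) := by
    have := pow_le_pow_left₀ hδ.le hab 2
    nlinarith [sq_nonneg (a - b)]
  have h3 : α ^ 2 * (Δc - 2 * M * ε) ^ 2 ≤ α * (a ^ 2 + b ^ 2) := by
    calc _ ≤ α ^ 2 * (2 * (a ^ 2 + b ^ 2)) := by gcongr
      _ = α * (a ^ 2 + b ^ 2) * (2 * α) := by ring
      _ ≤ α * (a ^ 2 + b ^ 2) * 1 := by gcongr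
      _ = _ := mul_one _
  rw [one_div, inv_mul_eq_div, le_div_iff₀ hBpos]
  calc _ ≤ α * (a ^ 2 + b ^ 2) * B := by gcongr
    _ = α * B * (a ^ 2 + b ^ 2) := by ring
    _ ≤ _ := h1.trans hsum
end
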